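/- Fix l ≥ 1 and ξ ≤ 0. For each n let g_n : ℂ → ℂ be the polynomial g_n(λ) = ∏_{k=0}^{n−1} (1 + λ x_{n,k}(ξ)). Then lim_{n→∞} Σ_{k=0}^{l−1} (1/k!) g_n^{(k)}(−1) = e^{ξ} Σ_{k=0}^{l−1} (−ξ)^k / k!, where g_n^{(k)} denotes the k-th complex derivative. (The left-hand side is the probability that the l-th largest modulus |z|_n^{(l)} of the eigenvalues of the hard edge ensemble satisfies R₀ n δ (|z|_n^{(l)} − R₀) log 4 ≤ ξ, and the right-hand side is F_hard^{(l)}(ξ).) -/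

import Mathlib

open MeasureTheory Filter Finset

/-- `V_{n,k}(r) = Q(r) − (2 − (2k+1)/n) log r`. -/
noncomputable def Vnk (Q : ℝ → ℝ) (n k : ℕ) (r : ℝ) : ℝ :=
  Q r - (2 - (2 * (k : ℝ) + 1) / n) * Real.log r

/-- The rescaled radius `x_n(ξ) = R₀ + ξ/(n R₀ δ log 4)`. -/
noncomputable def xn (R₀ δ : ℝ) (n : ℕ) (ξ : ℝ) : ℝ :=
  R₀ + ξ / (n * R₀ * δ * Real.log 4)

/-- The gap-probability factor
`x_{n,k}(ξ) = (∫_{x_n(ξ)}^{R₀} e^{−n V_{n,k}(r)} dr) / (∫_{r₀}^{R₀} e^{−n V_{n,k}(r)} dr)`. -/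
noncomputable def xnk (Q : ℝ → ℝ) (r₀ R₀ δ : ℝ) (n k : ℕ) (ξ : ℝ) : ℝ :=
  (∫ r in (xn R₀ δ n ξ)..R₀, Real.exp (-(n : ℝ) * Vnk Q n k r)) /
  (∫ r in r₀..R₀, Real.exp (-(n : ℝ) * Vnk Q n k r))

open scoped Topology

/-- A triangular array of small nonnegative weights with convergent row sums: the products
`∏ (1 + z x)` converge to the exponential, locally uniformly in `z`. -/
theorem tendstoLocallyUniformlyOn_prod_one_add_mul {x : ℕ → ℕ → ℝ} {s : ℝ} {B : ℕ → ℝ}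
    (hx : ∀ᶠ n in atTop, ∀ k < n, 0 ≤ x n k ∧ x n k ≤ B n) (hB : Tendsto B atTop (𝓝 0))
    (hs : Tendsto (fun n => ∑ k ∈ Finset.range n, x n k) atTop (𝓝 s)) :
    TendstoLocallyUniformlyOn
      (fun n (z : ℂ) => ∏ k ∈ Finset.range n, (1 + z * (x n k : ℂ)))
      (fun z => Complex.exp (s * z)) atTop Set.univ := by
  rw [tendstoLocallyUniformlyOn_iff_forall_tendsto]
  intro z _
  rw [nhdsWithin_univ]
  refine Tendsto.mono_right (Tendsto.prodMk_nhds (x := Complex.exp (s * z))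
    (y := Complex.exp (s * z)) ?_ ?_) (nhds_le_uniformity _)
  · have : Continuous fun z : ℂ => Complex.exp (s * z) := by fun_prop
    exact (this.tendsto z).comp tendsto_snd
  set R : ℝ := ‖z‖ + 1 with hR
  have hRpos : 0 < R := by positivity
  have hball : ∀ᶠ p : ℕ × ℂ in atTop ×ˢ 𝓝 z, ‖p.2‖ ≤ R := by
    have : ∀ᶠ y in 𝓝 z, ‖y‖ ≤ R :=
      (continuous_norm.tendsto z).eventually_le_const (by linarith)
    exact tendsto_snd.eventually this
  have hsmall : ∀ᶠ p : ℕ × ℂ in atTop ×ˢ 𝓝 z, R * B p.1 ≤ 1 / 2 := by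
    have h : Tendsto (fun n => R * B n) atTop (𝓝 0) := by simpa using hB.const_mul R
    exact tendsto_fst.eventually (h.eventually_le_const (by norm_num))
  have hx' : ∀ᶠ p : ℕ × ℂ in atTop ×ˢ 𝓝 z, ∀ k < p.1, 0 ≤ x p.1 k ∧ x p.1 k ≤ B p.1 :=
    tendsto_fst.eventually hx
  have hE : Tendsto (fun p : ℕ × ℂ => ∑ k ∈ Finset.range p.1,
      (Complex.log (1 + p.2 * x p.1 k) - p.2 * x p.1 k)) (atTop ×ˢ 𝓝 z) (𝓝 0) := by
    have hbound : Tendsto (fun p : ℕ × ℂ =>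
        R ^ 2 * (B p.1 * ∑ k ∈ Finset.range p.1, x p.1 k)) (atTop ×ˢ 𝓝 z) (𝓝 0) := by
      have h : Tendsto (fun n => R ^ 2 * (B n * ∑ k ∈ Finset.range n, x n k)) atTop (𝓝 0) := by
        simpa using (hB.mul hs).const_mul (R ^ 2)
      exact h.comp tendsto_fst
    refine squeeze_zero_norm' ?_ hbound
    filter_upwards [hball, hsmall, hx'] with p h1 h2 h3
    rw [Finset.mul_sum, Finset.mul_sum]
    refine (norm_sum_le _ _).trans (Finset.sum_le_sum fun k hk => ?_)
    obtain ⟨h4, h5⟩ := h3 k (Finset.mem_range.1 hk)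
    have hn : ‖p.2 * (x p.1 k : ℂ)‖ = ‖p.2‖ * x p.1 k := by
      rw [norm_mul, Complex.norm_real, Real.norm_of_nonneg h4]
    have hle : ‖p.2‖ * x p.1 k ≤ R * x p.1 k := mul_le_mul_of_nonneg_right h1 h4
    have hhalf : ‖p.2‖ * x p.1 k ≤ 1 / 2 :=
      hle.trans ((mul_le_mul_of_nonneg_left h5 hRpos.le).trans h2)
    refine (Complex.norm_log_one_add_sub_self_le (by rw [hn]; linarith)).trans ?_
    rw [hn]
    have hinv : (1 - ‖p.2‖ * x p.1 k)⁻¹ ≤ 2 := by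
      rw [inv_le_comm₀ (by linarith) (by norm_num)]
      linarith
    have h0 : 0 ≤ ‖p.2‖ * x p.1 k := by positivity
    calc (‖p.2‖ * x p.1 k) ^ 2 * (1 - ‖p.2‖ * x p.1 k)⁻¹ / 2
        ≤ (‖p.2‖ * x p.1 k) ^ 2 * 2 / 2 := by gcongr
      _ = (‖p.2‖ * x p.1 k) ^ 2 := by ring
      _ ≤ (R * x p.1 k) ^ 2 := by gcongr
      _ = R ^ 2 * (x p.1 k * x p.1 k) := by ring
      _ ≤ R ^ 2 * (B p.1 * x p.1 k) := by gcongr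
  have hlin : Tendsto (fun p : ℕ × ℂ => p.2 * ((∑ k ∈ Finset.range p.1, x p.1 k : ℝ) : ℂ))
      (atTop ×ˢ 𝓝 z) (𝓝 (z * s)) :=
    tendsto_snd.mul (((Complex.continuous_ofReal.tendsto s).comp hs).comp tendsto_fst)
  have hsum := hE.add hlin
  rw [zero_add, mul_comm z] at hsum
  refine ((Complex.continuous_exp.tendsto _).comp hsum).congr' ?_
  filter_upwards [hball, hsmall, hx'] with p h1 h2 h3
  simp only [Function.comp_apply]
  rw [Complex.ofReal_sum, Finset.mul_sum, ← Finset.sum_add_distrib, Complex.exp_sum]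
  refine Finset.prod_congr rfl fun k hk => ?_
  obtain ⟨h4, h5⟩ := h3 k (Finset.mem_range.1 hk)
  rw [sub_add_cancel, Complex.exp_log]
  intro h0
  have hn : ‖p.2 * (x p.1 k : ℂ)‖ = ‖p.2‖ * x p.1 k := by
    rw [norm_mul, Complex.norm_real, Real.norm_of_nonneg h4]
  have hle : ‖p.2‖ * x p.1 k ≤ R * B p.1 := by gcongr
  rw [eq_neg_of_add_eq_zero_right h0, norm_neg, norm_one] at hn
  linarith

theorem tendstoLocallyUniformlyOn_iteratedDeriv {F : ℕ → ℂ → ℂ} {f : ℂ → ℂ}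
    (hF : ∀ n, ContDiff ℂ ⊤ (F n)) (h : TendstoLocallyUniformlyOn F f atTop Set.univ) (k : ℕ) :
    TendstoLocallyUniformlyOn (fun n => iteratedDeriv k (F n)) (iteratedDeriv k f)
      atTop Set.univ := by
  induction k with
  | zero => simpa [iteratedDeriv_zero] using h
  | succ k ih =>
    simp only [iteratedDeriv_succ]
    refine ih.deriv (Eventually.of_forall fun n => ?_) isOpen_univ
    exact ((hF n).differentiable_iteratedDeriv k (by simp)).differentiableOn

theorem tendsto_sum_iteratedDeriv_prod_one_add_mul {x : ℕ → ℕ → ℝ} {s : ℝ} {B : ℕ → ℝ}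
    (hx : ∀ᶠ n in atTop, ∀ k < n, 0 ≤ x n k ∧ x n k ≤ B n) (hB : Tendsto B atTop (𝓝 0))
    (hs : Tendsto (fun n => ∑ k ∈ Finset.range n, x n k) atTop (𝓝 s)) (l : ℕ) :
    Tendsto
      (fun n : ℕ => ∑ k ∈ Finset.range l, (1 / (Nat.factorial k : ℂ)) *
        iteratedDeriv k (fun z : ℂ => ∏ j ∈ Finset.range n, (1 + z * (x n j : ℂ))) (-1))
      atTop
      (𝓝 ((Real.exp (-s) : ℂ) *
        ∑ k ∈ Finset.range l, (s : ℂ) ^ k / (Nat.factorial k : ℂ))) := by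
  rw [Finset.mul_sum]
  refine tendsto_finsetSum _ fun k _ => ?_
  have hsmooth : ∀ n, ContDiff ℂ ⊤ fun z : ℂ => ∏ j ∈ Finset.range n, (1 + z * (x n j : ℂ)) :=
    fun n => by fun_prop
  have h := (tendstoLocallyUniformlyOn_iteratedDeriv hsmooth
    (tendstoLocallyUniformlyOn_prod_one_add_mul hx hB hs) k).tendsto_at (Set.mem_univ (-1))
  rw [iteratedDeriv_cexp_const_mul] at h
  convert h.const_mul (1 / (Nat.factorial k : ℂ)) using 2
  push_cast
  rw [mul_neg_one]
  ring

/-- Local data at a hard edge: a cost `w` comparable to `κ u²` and a gain `ℓ` comparable to `m u`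
at distance `u ∈ [0, L]` from the edge. -/
structure IsHardEdgeProfile (w ℓ : ℝ → ℝ) (L κ m c C M : ℝ) : Prop where
  L_pos : 0 < L
  κ_pos : 0 < κ
  m_pos : 0 < m
  c_pos : 0 < c
  continuousOn_w : ContinuousOn w (Set.Icc 0 L)
  continuousOn_ℓ : ContinuousOn ℓ (Set.Icc 0 L)
  le_w : ∀ u ∈ Set.Icc 0 L, c * u ^ 2 ≤ w u
  w_le : ∀ u ∈ Set.Icc 0 L, w u ≤ C * u ^ 2
  le_ℓ : ∀ u ∈ Set.Icc 0 L, m * u ≤ ℓ u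
  ℓ_le : ∀ u ∈ Set.Icc 0 L, ℓ u ≤ M * u
  tendsto_w : Tendsto (fun u => w u / u ^ 2) (𝓝[>] 0) (𝓝 κ)
  tendsto_ℓ : Tendsto (fun u => ℓ u / u) (𝓝[>] 0) (𝓝 m)

theorem isHardEdgeProfile_of_contDiffOn {Q : ℝ → ℝ} {r₀ R₀ δ : ℝ}
    (hQ : ContDiffOn ℝ 3 Q (Set.Ioi 0))
    (hsub : ∀ r > (0 : ℝ), 0 ≤ deriv (deriv Q) r + deriv Q r / r)
    (hR₀ : R₀ * deriv Q R₀ = 2) (hr₀pos : 0 < r₀) (hr₀R₀ : r₀ < R₀)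
    (hδ : δ = (1 / 4) * (deriv (deriv Q) R₀ + deriv Q R₀ / R₀)) (hδpos : 0 < δ) :
    ∃ c C, IsHardEdgeProfile
      (fun u => (Q (R₀ - u) - 2 * Real.log (R₀ - u)) - (Q R₀ - 2 * Real.log R₀))
      (fun u => Real.log R₀ - Real.log (R₀ - u)) (R₀ - r₀) (2 * δ) (1 / R₀) c C (1 / r₀) := by
  have hR₀pos : 0 < R₀ := hr₀pos.trans hr₀R₀
  set W : ℝ → ℝ := fun r => Q r - 2 * Real.log r with hW
  set w : ℝ → ℝ := fun u => (Q (R₀ - u) - 2 * Real.log (R₀ - u)) - (Q R₀ - 2 * Real.log R₀) with hw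
  set L := R₀ - r₀ with hL
  have hLpos : 0 < L := sub_pos.2 hr₀R₀
  have hQ1 : ∀ r > 0, HasDerivAt Q (deriv Q r) r := fun r hr =>
    ((hQ.differentiableOn (by norm_num)).differentiableAt (Ioi_mem_nhds hr)).hasDerivAt
  have hQ' : ContDiffOn ℝ 2 (deriv Q) (Set.Ioi 0) :=
    hQ.deriv_of_isOpen isOpen_Ioi (by norm_num)
  have hQ2 : ∀ r > 0, HasDerivAt (deriv Q) (deriv (deriv Q) r) r := fun r hr =>
    ((hQ'.differentiableOn (by norm_num)).differentiableAt (Ioi_mem_nhds hr)).hasDerivAt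
  have hW1 : ∀ r > 0, HasDerivAt W (deriv Q r - 2 / r) r := fun r hr => by
    exact ((hQ1 r hr).sub ((Real.hasDerivAt_log hr.ne').const_mul 2)).congr_deriv
      (by rw [div_eq_mul_inv])
  have hmono : MonotoneOn (fun r => r * deriv Q r) (Set.Ioi 0) := by
    have hd : ∀ r > 0, HasDerivAt (fun r => r * deriv Q r)
        (1 * deriv Q r + r * deriv (deriv Q) r) r := fun r hr => (hasDerivAt_id r).mul (hQ2 r hr)
    refine monotoneOn_of_deriv_nonneg (convex_Ioi 0)
      (fun r hr => (hd r hr).continuousAt.continuousWithinAt) ?_ ?_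
    · rw [interior_Ioi]
      exact fun r hr => (hd r hr).differentiableAt.differentiableWithinAt
    · rw [interior_Ioi]
      intro r hr
      have hr' : (0 : ℝ) < r := hr
      rw [(hd r hr).deriv]
      have := mul_nonneg hr'.le (hsub r hr)
      have h2 : r * (deriv (deriv Q) r + deriv Q r / r)
        = 1 * deriv Q r + r * deriv (deriv Q) r := by field_simp; ring
      linarith
  have hWanti : AntitoneOn W (Set.Ioc 0 R₀) := by
    refine antitoneOn_of_deriv_nonpos (convex_Ioc 0 R₀)
      (fun r hr => (hW1 r hr.1).continuousAt.continuousWithinAt) ?_ ?_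
    · rw [interior_Ioc]
      exact fun r hr => (hW1 r hr.1).differentiableAt.differentiableWithinAt
    · rw [interior_Ioc]
      intro r hr
      rw [(hW1 r hr.1).deriv, sub_nonpos, le_div_iff₀ hr.1, mul_comm]
      have := hmono hr.1 hR₀pos hr.2.le
      simpa [hR₀] using this
  have hw1 : ∀ u < R₀, HasDerivAt w (-(deriv Q (R₀ - u) - 2 / (R₀ - u))) u := fun u hu => by
    have h1 : HasDerivAt (fun u => R₀ - u) (-1) u := (hasDerivAt_id u).const_sub R₀
    exact (((hW1 (R₀ - u) (sub_pos.2 hu)).comp u h1).sub_const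
      (Q R₀ - 2 * Real.log R₀)).congr_deriv (mul_neg_one _)
  have hw0 : w 0 = 0 := by simp [hw]
  have hwcont : ContinuousOn w (Set.Icc 0 L) := fun u hu =>
    (hw1 u (by have := hu.2; linarith)).continuousAt.continuousWithinAt
  have hlim : Tendsto (fun u => w u / u ^ 2) (𝓝[>] 0) (𝓝 (2 * δ)) := by
    have hlt : ∀ᶠ u in 𝓝[>] (0 : ℝ), u < R₀ :=
      nhdsWithin_le_nhds (Iio_mem_nhds hR₀pos)
    refine HasDerivAt.lhopital_zero_nhdsGT (g' := fun u => 2 * u) (hlt.mono hw1)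
      (Eventually.of_forall fun u => by simpa using hasDerivAt_pow 2 u) ?_ ?_ ?_ ?_
    · filter_upwards [self_mem_nhdsWithin] with u hu
      have : (0 : ℝ) < u := hu
      positivity
    · have := (hw1 0 hR₀pos).continuousAt.tendsto
      rw [hw0] at this
      exact this.mono_left nhdsWithin_le_nhds
    · have : Tendsto (fun u : ℝ => u ^ 2) (𝓝 0) (𝓝 (0 ^ 2)) := (continuous_pow 2).tendsto 0
      simpa using this.mono_left nhdsWithin_le_nhds
    · have h1 : HasDerivAt (fun u => R₀ - u) (-1) 0 := (hasDerivAt_id 0).const_sub R₀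
      have h2 : HasDerivAt (fun r => deriv Q r - 2 / r)
          (deriv (deriv Q) (R₀ - 0) - 2 * (-((R₀ - 0) ^ 2)⁻¹)) (R₀ - 0) := by
        have hpos : (0 : ℝ) < R₀ - 0 := by simpa using hR₀pos
        simp only [div_eq_mul_inv]
        exact (hQ2 _ hpos).sub ((hasDerivAt_inv hpos.ne').const_mul 2)
      have h3 := (h2.comp 0 h1).neg
      have h4 := h3.tendsto_slope.mono_left (nhdsWithin_mono 0
        (show Set.Ioi (0 : ℝ) ⊆ {0}ᶜ from fun u hu => (ne_of_gt hu)))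
      have h5 := h4.div_const 2
      have hQR : deriv Q R₀ = 2 / R₀ := by field_simp; linarith
      have hval : -((deriv (deriv Q) (R₀ - 0) - 2 * (-((R₀ - 0) ^ 2)⁻¹)) * -1) / 2 = 2 * δ := by
        rw [hδ, hQR, sub_zero]
        field_simp
        ring
      rw [hval] at h5
      refine h5.congr fun u => ?_
      simp only [slope_def_field, Pi.neg_apply, Function.comp_apply, sub_zero]
      rw [hQR]
      ring
  have hev : ∀ᶠ u in 𝓝[>] (0 : ℝ), δ ≤ w u / u ^ 2 ∧ w u / u ^ 2 ≤ 3 * δ :=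
    (hlim.eventually_const_le (by linarith)).and (hlim.eventually_le_const (by linarith))
  obtain ⟨ε, hε, hεsub⟩ := mem_nhdsGT_iff_exists_Ioo_subset.1 hev
  have hε' : (0 : ℝ) < ε := hε
  set u₁ := min (ε / 2) L with hu₁
  have hu₁pos : 0 < u₁ := lt_min (by linarith) hLpos
  have hu₁L : u₁ ≤ L := min_le_right _ _
  have hnear : ∀ u, 0 < u → u ≤ u₁ → δ * u ^ 2 ≤ w u ∧ w u ≤ 3 * δ * u ^ 2 := fun u h0 h1 => by
    have h2 : δ ≤ w u / u ^ 2 ∧ w u / u ^ 2 ≤ 3 * δ :=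
      hεsub ⟨h0, by have := min_le_left (ε / 2) L; linarith⟩
    have h3 : 0 < u ^ 2 := by positivity
    rwa [le_div_iff₀ h3, div_le_iff₀ h3] at h2
  have hfar : ∀ u ∈ Set.Icc u₁ L, w u₁ ≤ w u ∧ w u ≤ w L := fun u hu => by
    have ha : ∀ a b, 0 ≤ a → a ≤ b → b ≤ L → w a ≤ w b := fun a b h0 hab hb => by
      have : W (R₀ - a) ≤ W (R₀ - b) :=
        hWanti ⟨by linarith, by linarith⟩ ⟨by linarith, by linarith⟩ (by linarith)
      simp only [hw]
      simp only [hW] at this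
      linarith
    exact ⟨ha _ _ hu₁pos.le hu.1 hu.2, ha _ _ (hu₁pos.le.trans hu.1) hu.2 le_rfl⟩
  have hwL : 0 ≤ w L := by
    have h1 := (hnear u₁ hu₁pos le_rfl).1
    have h2 := (hfar L ⟨hu₁L, le_rfl⟩).1
    have : 0 ≤ δ * u₁ ^ 2 := by positivity
    linarith
  refine ⟨δ * (u₁ / L) ^ 2, 3 * δ + w L / u₁ ^ 2, hLpos, by positivity, by positivity,
    by positivity, hwcont, ?_, ?_, ?_, ?_, ?_, hlim, ?_⟩
  · refine continuousOn_const.sub (ContinuousOn.log (by fun_prop) fun u hu => ?_)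
    have := hu.2
    exact (show 0 < R₀ - u by linarith).ne'
  · intro u hu
    rcases hu.1.eq_or_lt with rfl | h0
    · simp [hw0]
    have hratio : u₁ / L ≤ 1 := (div_le_one hLpos).2 hu₁L
    rcases le_total u u₁ with h | h
    · refine le_trans ?_ (hnear u h0 h).1
      have : (u₁ / L) ^ 2 ≤ 1 := pow_le_one₀ (by positivity) hratio
      have hp : 0 ≤ δ * u ^ 2 := by positivity
      nlinarith
    · refine le_trans ?_ ((hnear u₁ hu₁pos le_rfl).1.trans (hfar u ⟨h, hu.2⟩).1)
      rw [mul_assoc, ← mul_pow]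
      have : u₁ / L * u ≤ u₁ := by
        rw [div_mul_eq_mul_div, div_le_iff₀ hLpos]
        exact mul_le_mul_of_nonneg_left hu.2 hu₁pos.le
      gcongr
  · intro u hu
    rcases hu.1.eq_or_lt with rfl | h0
    · simp [hw0]
    rw [add_mul]
    rcases le_total u u₁ with h | h
    · have : 0 ≤ w L / u₁ ^ 2 * u ^ 2 := by positivity
      linarith [(hnear u h0 h).2]
    · have h1 : w L ≤ w L / u₁ ^ 2 * u ^ 2 := by
        rw [div_mul_eq_mul_div, le_div_iff₀ (by positivity)]
        gcongr
      have h2 : 0 ≤ 3 * δ * u ^ 2 := by positivity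
      linarith [(hfar u ⟨h, hu.2⟩).2]
  · intro u hu
    have hpos : 0 < R₀ - u := by have := hu.2; linarith
    have h := Real.log_le_sub_one_of_pos (show 0 < (R₀ - u) / R₀ by positivity)
    rw [Real.log_div hpos.ne' hR₀pos.ne'] at h
    have h2 : (R₀ - u) / R₀ - 1 = -(1 / R₀ * u) := by field_simp; ring
    linarith
  · intro u hu
    have hle : r₀ ≤ R₀ - u := by have := hu.2; linarith
    have hpos : 0 < R₀ - u := hr₀pos.trans_le hle
    have h := Real.log_le_sub_one_of_pos (show 0 < R₀ / (R₀ - u) by positivity)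
    rw [Real.log_div hR₀pos.ne' hpos.ne'] at h
    have h2 : R₀ / (R₀ - u) - 1 = u / (R₀ - u) := by field_simp; ring
    have h3 : u / (R₀ - u) ≤ u / r₀ := div_le_div_of_nonneg_left hu.1 hr₀pos hle
    have h4 : u / r₀ = 1 / r₀ * u := by ring
    linarith
  · have h1 : HasDerivAt (fun u => R₀ - u) (-1) 0 := (hasDerivAt_id 0).const_sub R₀
    have hpos : R₀ - 0 ≠ 0 := by simpa using hR₀pos.ne'
    have h2 := (h1.log hpos).const_sub (Real.log R₀)
    have h4 := h2.tendsto_slope.mono_left (nhdsWithin_mono 0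
      (show Set.Ioi (0 : ℝ) ⊆ {0}ᶜ from fun u hu => (ne_of_gt hu)))
    have hval : -(-1 / (R₀ - 0)) = 1 / R₀ := by simp [neg_div]
    rw [hval] at h4
    refine h4.congr fun u => ?_
    simp [slope_def_field]

/-- The half-line Gaussian integral with a linear term, by completing the square. -/
theorem integral_Ioi_exp_linear_sub_sq {κ : ℝ} (hκ : 0 < κ) (β : ℝ) :
    ∫ v in Set.Ioi (0 : ℝ), Real.exp (β * v - κ * v ^ 2) =
      Real.exp (β ^ 2 / (4 * κ)) *
        (√(Real.pi / κ) / 2 + ∫ s in (0 : ℝ)..β / (2 * κ), Real.exp (-κ * s ^ 2)) := by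
  set p := β / (2 * κ) with hp
  set f : ℝ → ℝ := fun s => Real.exp (-κ * s ^ 2) with hf
  have hfi : Integrable f := integrable_exp_neg_mul_sq hκ
  have hfii : ∀ a b, IntervalIntegrable f volume a b := fun a b => hfi.intervalIntegrable
  have hsq : ∀ v, Real.exp (β * v - κ * v ^ 2) = Real.exp (β ^ 2 / (4 * κ)) * f (v - p) := by
    intro v
    rw [hf, ← Real.exp_add, hp]
    congr 1
    field_simp
    ring
  simp_rw [hsq]
  rw [integral_const_mul]
  congr 1
  have h1 : Tendsto (fun b => ∫ v in (0 : ℝ)..b, f (v - p)) atTop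
      (𝓝 (∫ v in Set.Ioi 0, f (v - p))) :=
    intervalIntegral_tendsto_integral_Ioi 0 (hfi.comp_sub_right p).integrableOn tendsto_id
  have h2 : Tendsto (fun b => ∫ v in (0 : ℝ)..b - p, f v) atTop (𝓝 (∫ v in Set.Ioi 0, f v)) :=
    intervalIntegral_tendsto_integral_Ioi 0 hfi.integrableOn
      (tendsto_atTop_add_const_right _ _ tendsto_id)
  have hsymm : ∫ v in (-p)..0, f v = ∫ v in (0 : ℝ)..p, f v := by
    have := intervalIntegral.integral_comp_neg (a := 0) (b := p) f
    rw [neg_zero] at this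
    rw [← this]
    simp [hf]
  rw [show ∫ v in Set.Ioi 0, f v = √(Real.pi / κ) / 2 from integral_gaussian_Ioi κ] at h2
  refine tendsto_nhds_unique h1 ((h2.add_const (∫ s in (0 : ℝ)..p, f s)).congr fun b => ?_)
  rw [intervalIntegral.integral_comp_sub_right, zero_sub, ← hsymm, add_comm,
    intervalIntegral.integral_add_adjacent_intervals (hfii _ _) (hfii _ _)]

theorem integral_Ioi_inv_integral_Ioi_exp {κ m : ℝ} (hκ : 0 < κ) (hm : 0 < m) :
    ∫ y in Set.Ioi (0 : ℝ), (∫ v in Set.Ioi (0 : ℝ), Real.exp (2 * y * m * v - κ * v ^ 2))⁻¹ =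
      κ / m * Real.log 2 := by
  set A : ℝ := √(Real.pi / κ) / 2 with hA
  have hApos : 0 < A := by positivity
  set f : ℝ → ℝ := fun s => Real.exp (-κ * s ^ 2) with hf
  have hfc : Continuous f := by fun_prop
  set J : ℝ → ℝ := fun p => A + ∫ s in (0 : ℝ)..p, f s with hJ
  have hJ' : ∀ p, HasDerivAt J (f p) p := fun p =>
    (intervalIntegral.integral_hasDerivAt_right (hfc.intervalIntegrable _ _)
      hfc.stronglyMeasurable.stronglyMeasurableAtFilter hfc.continuousAt).const_add A
  have hJpos : ∀ p, 0 ≤ p → 0 < J p := fun p hp => by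
    have : 0 ≤ ∫ s in (0 : ℝ)..p, f s :=
      intervalIntegral.integral_nonneg hp fun s _ => (Real.exp_pos _).le
    simp only [hJ]
    linarith
  have hJlim : Tendsto J atTop (𝓝 (A + A)) := by
    have h : Tendsto (fun b => ∫ v in (0 : ℝ)..b, f v) atTop (𝓝 (∫ v in Set.Ioi 0, f v)) :=
      intervalIntegral_tendsto_integral_Ioi 0 (integrable_exp_neg_mul_sq hκ).integrableOn tendsto_id
    rw [show ∫ v in Set.Ioi 0, f v = A from integral_gaussian_Ioi κ] at h
    exact h.const_add A
  have hmκ : 0 < m / κ := by positivity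
  have hlin : ∀ y, HasDerivAt (fun y : ℝ => m / κ * y) (m / κ) y := fun y => by
    simpa using (hasDerivAt_id y).const_mul (m / κ)
  have hg : ∀ y, 0 ≤ y → HasDerivAt (fun y => κ / m * Real.log (J (m / κ * y)))
      (∫ v in Set.Ioi (0 : ℝ), Real.exp (2 * y * m * v - κ * v ^ 2))⁻¹ y := by
    intro y hy
    have hpos : 0 < J (m / κ * y) := hJpos _ (by positivity)
    refine ((((hJ' _).comp y (hlin y)).log hpos.ne').const_mul (κ / m)).congr_deriv ?_
    rw [integral_Ioi_exp_linear_sub_sq hκ, show 2 * y * m / (2 * κ) = m / κ * y by field_simp,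
      show (2 * y * m) ^ 2 / (4 * κ) = -(-κ * (m / κ * y) ^ 2) by field_simp; ring, Real.exp_neg]
    change κ / m * (f (m / κ * y) * (m / κ) / J (m / κ * y)) =
      ((f (m / κ * y))⁻¹ * J (m / κ * y))⁻¹
    rw [mul_inv, inv_inv]
    field_simp
  have hlim : Tendsto (fun y => κ / m * Real.log (J (m / κ * y))) atTop
      (𝓝 (κ / m * Real.log (A + A))) :=
    ((hJlim.comp (tendsto_id.const_mul_atTop hmκ)).log (by positivity)).const_mul _
  rw [integral_Ioi_of_hasDerivAt_of_nonneg (hg 0 le_rfl).continuousAt.continuousWithinAt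
    (fun y hy => hg y (le_of_lt hy)) (fun y _ => inv_nonneg.2
      (integral_nonneg fun v => (Real.exp_pos _).le)) hlim, ← mul_sub]
  congr 1
  have hJ0 : J (m / κ * 0) = A := by simp [hJ]
  rw [hJ0, ← Real.log_div (by positivity) hApos.ne', ← two_mul, mul_div_assoc, div_self hApos.ne',
    mul_one]

/-- The weight `e^{-n w(u) + (2k+1) ℓ(u)}` at distance `u` from the edge. -/
noncomputable def edgeWeight (w ℓ : ℝ → ℝ) (n k : ℕ) (u : ℝ) : ℝ :=
  Real.exp (-(n * w u) + (2 * k + 1) * ℓ u)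

theorem edgeWeight_pos (w ℓ : ℝ → ℝ) (n k : ℕ) (u : ℝ) : 0 < edgeWeight w ℓ n k u :=
  Real.exp_pos _

/-- The proportion of the weight on `[0, L]` lying within `a / n` of the edge. -/
noncomputable def edgeRatio (w ℓ : ℝ → ℝ) (L a : ℝ) (n k : ℕ) : ℝ :=
  (∫ u in (0 : ℝ)..a / n, edgeWeight w ℓ n k u) / ∫ u in (0 : ℝ)..L, edgeWeight w ℓ n k u

namespace IsHardEdgeProfile

variable {w ℓ : ℝ → ℝ} {L κ m c C M : ℝ}

theorem M_pos (h : IsHardEdgeProfile w ℓ L κ m c C M) : 0 < M := by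
  have h1 := (h.le_ℓ L ⟨h.L_pos.le, le_rfl⟩).trans (h.ℓ_le L ⟨h.L_pos.le, le_rfl⟩)
  exact h.m_pos.trans_le (le_of_mul_le_mul_right h1 h.L_pos)

theorem C_pos (h : IsHardEdgeProfile w ℓ L κ m c C M) : 0 < C := by
  have h1 := (h.le_w L ⟨h.L_pos.le, le_rfl⟩).trans (h.w_le L ⟨h.L_pos.le, le_rfl⟩)
  exact h.c_pos.trans_le (le_of_mul_le_mul_right h1 (pow_pos h.L_pos 2))

theorem continuousOn_edgeWeight (h : IsHardEdgeProfile w ℓ L κ m c C M) (n k : ℕ) :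
    ContinuousOn (edgeWeight w ℓ n k) (Set.Icc 0 L) :=
  Real.continuous_exp.comp_continuousOn
    ((h.continuousOn_w.const_mul _).neg.add (h.continuousOn_ℓ.const_mul _))

theorem intervalIntegrable_edgeWeight (h : IsHardEdgeProfile w ℓ L κ m c C M) (n k : ℕ) {a b : ℝ}
    (ha : 0 ≤ a) (hab : a ≤ b) (hb : b ≤ L) :
    IntervalIntegrable (edgeWeight w ℓ n k) volume a b := by
  refine ((h.continuousOn_edgeWeight n k).mono ?_).intervalIntegrable
  rw [Set.uIcc_of_le hab]
  exact Set.Icc_subset_Icc ha hb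

theorem edgeWeight_le (h : IsHardEdgeProfile w ℓ L κ m c C M) (n k : ℕ) {u : ℝ}
    (hu : u ∈ Set.Icc 0 L) :
    edgeWeight w ℓ n k u ≤ Real.exp (-(n * (c * u ^ 2)) + (2 * k + 1) * (M * u)) := by
  have h1 := h.le_w u hu
  have h2 := h.ℓ_le u hu
  unfold edgeWeight
  gcongr

theorem le_edgeWeight (h : IsHardEdgeProfile w ℓ L κ m c C M) (n k : ℕ) {u : ℝ}
    (hu : u ∈ Set.Icc 0 L) :
    Real.exp (-(n * (C * u ^ 2)) + (2 * k + 1) * (m * u)) ≤ edgeWeight w ℓ n k u := by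
  have h1 := h.w_le u hu
  have h2 := h.le_ℓ u hu
  unfold edgeWeight
  gcongr

theorem integral_window_le (h : IsHardEdgeProfile w ℓ L κ m c C M) (n k : ℕ) {a : ℝ}
    (ha : 0 ≤ a) (hn : 0 < (n : ℝ)) (hL : a / n ≤ L) :
    ∫ u in (0 : ℝ)..a / n, edgeWeight w ℓ n k u ≤
      a / n * Real.exp ((2 * k + 1) / n * (M * a)) := by
  have hM := h.M_pos
  have hc := h.c_pos
  have h0 : 0 ≤ a / n := by positivity
  have := intervalIntegral.integral_mono_on h0
    (h.intervalIntegrable_edgeWeight n k le_rfl h0 hL) intervalIntegrable_const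
    (g := fun _ => Real.exp ((2 * k + 1) / n * (M * a))) fun u hu => by
      refine (h.edgeWeight_le n k ⟨hu.1, hu.2.trans hL⟩).trans (Real.exp_le_exp.2 ?_)
      have h3 : (2 * (k : ℝ) + 1) * (M * u) ≤ (2 * k + 1) * (M * (a / n)) := by
        have := hu.2
        gcongr
      have h4 : (2 * (k : ℝ) + 1) * (M * (a / n)) = (2 * k + 1) / n * (M * a) := by ring
      have h5 : 0 ≤ (n : ℝ) * (c * u ^ 2) := by positivity
      linarith
  rwa [intervalIntegral.integral_const, sub_zero, smul_eq_mul] at this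

/-- Laplace asymptotics of the full integral on the scale `1/√n`. -/
theorem tendsto_sqrt_mul_integral (h : IsHardEdgeProfile w ℓ L κ m c C M) {k : ℕ → ℕ} {t : ℝ}
    (ht : Tendsto (fun n : ℕ => (2 * (k n : ℝ) + 1) / √n) atTop (𝓝 t)) :
    Tendsto (fun n : ℕ => √n * ∫ u in (0 : ℝ)..L, edgeWeight w ℓ n (k n) u) atTop
      (𝓝 (∫ v in Set.Ioi (0 : ℝ), Real.exp (t * m * v - κ * v ^ 2))) := by
  have hM := h.M_pos
  have hc := h.c_pos
  have hsqrt : Tendsto (fun n : ℕ => √(n : ℝ)) atTop atTop :=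
    Real.tendsto_sqrt_atTop.comp tendsto_natCast_atTop_atTop
  set F : ℕ → ℝ → ℝ := fun n => (Set.Ioc 0 (√n * L)).indicator
    fun v => edgeWeight w ℓ n (k n) (v / √n) with hF
  have hscale : ∀ᶠ n : ℕ in atTop,
      ∫ v in Set.Ioi (0 : ℝ), F n v = √n * ∫ u in (0 : ℝ)..L, edgeWeight w ℓ n (k n) u := by
    filter_upwards [eventually_gt_atTop 0] with n hn
    have hpos : 0 < √(n : ℝ) := Real.sqrt_pos.2 (Nat.cast_pos.2 hn)
    have h1 := intervalIntegral.integral_comp_div (a := 0) (b := √n * L)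
      (edgeWeight w ℓ n (k n)) hpos.ne'
    rw [zero_div, mul_div_cancel_left₀ _ hpos.ne', smul_eq_mul] at h1
    rw [← h1, hF, setIntegral_indicator measurableSet_Ioc,
      Set.inter_eq_right.2 Set.Ioc_subset_Ioi_self,
      intervalIntegral.integral_of_le (mul_nonneg hpos.le h.L_pos.le)]
  refine Tendsto.congr' hscale ?_
  set T := t + 1 with hT
  have hTev : ∀ᶠ n : ℕ in atTop, (2 * (k n : ℝ) + 1) / √n ≤ T :=
    ht.eventually_le_const (by linarith)
  have hmem : ∀ {n : ℕ} {v : ℝ}, 0 < √(n : ℝ) → v ∈ Set.Ioc 0 (√n * L) →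
      v / √n ∈ Set.Icc 0 L := fun hn hv =>
    ⟨div_nonneg hv.1.le hn.le, (div_le_iff₀ hn).2 (by rw [mul_comm]; exact hv.2)⟩
  refine tendsto_integral_filter_of_dominated_convergence
    (fun v => Real.exp ((T * M) ^ 2 / (2 * c)) * Real.exp (-(c / 2) * v ^ 2)) ?_ ?_
    ((integrable_exp_neg_mul_sq (by positivity)).const_mul _).integrableOn ?_
  · filter_upwards [hsqrt.eventually_gt_atTop 0] with n hn
    refine AEStronglyMeasurable.restrict ?_
    rw [hF, aestronglyMeasurable_indicator_iff measurableSet_Ioc]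
    refine ContinuousOn.aestronglyMeasurable ?_ measurableSet_Ioc
    exact (h.continuousOn_edgeWeight n (k n)).comp (by fun_prop) fun v hv => hmem hn hv
  · filter_upwards [hsqrt.eventually_gt_atTop 0, hTev] with n hn hTn
    refine Eventually.of_forall fun v => ?_
    by_cases hv : v ∈ Set.Ioc 0 (√n * L)
    · simp only [hF, Set.indicator_of_mem hv]
      rw [Real.norm_of_nonneg (edgeWeight_pos ..).le, ← Real.exp_add]
      refine (h.edgeWeight_le n (k n) (hmem hn hv)).trans (Real.exp_le_exp.2 ?_)
      have hv0 : 0 < v := hv.1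
      have h1 : (n : ℝ) * (c * (v / √n) ^ 2) = c * v ^ 2 := by
        rw [div_pow, Real.sq_sqrt (Nat.cast_nonneg n)]
        have : (n : ℝ) ≠ 0 := fun h0 => by simp [h0] at hn
        field_simp
      have h2 : (2 * (k n : ℝ) + 1) * (M * (v / √n)) = (2 * (k n : ℝ) + 1) / √n * (M * v) := by ring
      have h3 : (2 * (k n : ℝ) + 1) / √n * (M * v) ≤ T * (M * v) := by gcongr
      have h4 : 0 ≤ c / 2 * (v - T * M / c) ^ 2 := by positivity
      have h5 : c / 2 * (v - T * M / c) ^ 2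
          = c / 2 * v ^ 2 - T * (M * v) + (T * M) ^ 2 / (2 * c) := by field_simp; ring
      rw [h1, h2]
      linarith
    · simp only [hF, Set.indicator_of_notMem hv, norm_zero]
      positivity
  · filter_upwards [ae_restrict_mem measurableSet_Ioi] with v hv
    have hv0 : (0 : ℝ) < v := hv
    have hh : Tendsto (fun n : ℕ => v / √(n : ℝ)) atTop (𝓝[>] 0) :=
      tendsto_nhdsWithin_iff.2 ⟨hsqrt.const_div_atTop v,
        (hsqrt.eventually_gt_atTop 0).mono fun n hn => div_pos hv0 hn⟩
    have hlim : Tendsto (fun n : ℕ => (2 * (k n : ℝ) + 1) / √n * (ℓ (v / √n) / (v / √n)) * v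
        - w (v / √n) / (v / √n) ^ 2 * v ^ 2) atTop (𝓝 (t * m * v - κ * v ^ 2)) :=
      ((ht.mul (h.tendsto_ℓ.comp hh)).mul_const v).sub
        ((h.tendsto_w.comp hh).mul_const (v ^ 2))
    refine ((Real.continuous_exp.tendsto _).comp hlim).congr' ?_
    have hL' : Tendsto (fun n : ℕ => √(n : ℝ) * L) atTop atTop := hsqrt.atTop_mul_const h.L_pos
    filter_upwards [hsqrt.eventually_gt_atTop 0, hL'.eventually_ge_atTop v] with n hn hvn
    simp only [hF, Set.indicator_of_mem (show v ∈ Set.Ioc 0 (√n * L) from ⟨hv0, hvn⟩),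
      Function.comp_apply, edgeWeight]
    congr 1
    have hn2 : (n : ℝ) = √n ^ 2 := (Real.sq_sqrt (Nat.cast_nonneg n)).symm
    have h1 : w (v / √n) / (v / √n) ^ 2 * v ^ 2 = √n ^ 2 * w (v / √n) := by field_simp
    have h2 : (2 * (k n : ℝ) + 1) / √n * (ℓ (v / √n) / (v / √n)) * v =
        (2 * k n + 1) * ℓ (v / √n) := by field_simp
    rw [h1, h2, ← hn2]
    ring

/-- On the window of width `a / n` the weight is asymptotically constant when `k = O(√n)`. -/
theorem tendsto_mul_integral_window (h : IsHardEdgeProfile w ℓ L κ m c C M) {a : ℝ} (ha : 0 ≤ a)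
    {k : ℕ → ℕ} {t : ℝ}
    (ht : Tendsto (fun n : ℕ => (2 * (k n : ℝ) + 1) / √n) atTop (𝓝 t)) :
    Tendsto (fun n : ℕ => n * ∫ u in (0 : ℝ)..a / n, edgeWeight w ℓ n (k n) u) atTop (𝓝 a) := by
  have hC := h.C_pos
  have hT : Tendsto (fun n : ℕ => (2 * (k n : ℝ) + 1) / n) atTop (𝓝 0) := by
    have hsqrt : Tendsto (fun n : ℕ => √(n : ℝ)) atTop atTop :=
      Real.tendsto_sqrt_atTop.comp tendsto_natCast_atTop_atTop
    refine (ht.div_atTop hsqrt).congr fun n => ?_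
    rw [div_div, Real.mul_self_sqrt (Nat.cast_nonneg n)]
  have hn : Tendsto (fun n : ℕ => (n : ℝ)) atTop atTop := tendsto_natCast_atTop_atTop
  have hanL : ∀ᶠ n : ℕ in atTop, a / n ≤ L :=
    (hn.const_div_atTop a).eventually_le_const h.L_pos
  have hlow : Tendsto (fun n : ℕ => a * Real.exp (-(C * a ^ 2 / n))) atTop (𝓝 a) := by
    have : Tendsto (fun n : ℕ => -(C * a ^ 2 / n)) atTop (𝓝 0) := by
      simpa using (hn.const_div_atTop (C * a ^ 2)).neg
    simpa using ((Real.continuous_exp.tendsto 0).comp this).const_mul a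
  have hupp : Tendsto (fun n : ℕ => a * Real.exp ((2 * (k n : ℝ) + 1) / n * (M * a))) atTop
      (𝓝 a) := by
    have : Tendsto (fun n : ℕ => (2 * (k n : ℝ) + 1) / n * (M * a)) atTop (𝓝 0) := by
      simpa using hT.mul_const (M * a)
    simpa using ((Real.continuous_exp.tendsto 0).comp this).const_mul a
  refine tendsto_of_tendsto_of_tendsto_of_le_of_le' hlow hupp ?_ ?_
  · filter_upwards [hanL, hn.eventually_gt_atTop 0] with n h1 h2
    have h0 : 0 ≤ a / n := by positivity
    have := intervalIntegral.integral_mono_on h0 intervalIntegrable_const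
      (h.intervalIntegrable_edgeWeight n (k n) le_rfl h0 h1)
      (f := fun _ => Real.exp (-(C * a ^ 2 / n))) fun u hu => by
        refine le_trans (Real.exp_le_exp.2 ?_) (h.le_edgeWeight n (k n) ⟨hu.1, hu.2.trans h1⟩)
        have h3 : (n : ℝ) * (C * u ^ 2) ≤ n * (C * (a / n) ^ 2) := by
          have := hu.1
          have := hu.2
          gcongr
        have h4 : (n : ℝ) * (C * (a / n) ^ 2) = C * a ^ 2 / n := by field_simp
        have h5 : 0 ≤ (2 * (k n : ℝ) + 1) * (m * u) :=
          mul_nonneg (by positivity) (mul_nonneg h.m_pos.le hu.1)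
        linarith
    rw [intervalIntegral.integral_const, sub_zero, smul_eq_mul] at this
    calc a * Real.exp (-(C * a ^ 2 / n)) = n * (a / n * Real.exp (-(C * a ^ 2 / n))) := by
          field_simp
      _ ≤ _ := by gcongr
  · filter_upwards [hanL, hn.eventually_gt_atTop 0] with n h1 h2
    have h0 : 0 ≤ a / n := by positivity
    have := h.integral_window_le n (k n) ha h2 h1
    calc _ ≤ (n : ℝ) * (a / n * Real.exp ((2 * (k n : ℝ) + 1) / n * (M * a))) := by gcongr
      _ = _ := by field_simp

theorem le_integral_edgeWeight (h : IsHardEdgeProfile w ℓ L κ m c C M) {n : ℕ} (k : ℕ)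
    (hn : 0 < √(n : ℝ)) (hL : 1 / √n ≤ L) :
    1 / (2 * √n) * Real.exp (-C + m / 2 * ((2 * k + 1) / √n)) ≤
      ∫ u in (0 : ℝ)..L, edgeWeight w ℓ n k u := by
  have hm := h.m_pos
  have hC := h.C_pos
  have hhalf : 1 / (2 * √(n : ℝ)) ≤ 1 / √n :=
    one_div_le_one_div_of_le hn (by linarith)
  have h0 : 0 ≤ 1 / (2 * √(n : ℝ)) := by positivity
  have h1 := intervalIntegral.integral_mono_on hhalf intervalIntegrable_const
    (h.intervalIntegrable_edgeWeight n k h0 hhalf hL)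
    (f := fun _ => Real.exp (-C + m / 2 * ((2 * k + 1) / √n))) fun u hu => by
      have hu0 : 0 ≤ u := h0.trans hu.1
      refine le_trans (Real.exp_le_exp.2 ?_) (h.le_edgeWeight n k ⟨hu0, hu.2.trans hL⟩)
      have h2 : (n : ℝ) * (C * u ^ 2) ≤ n * (C * (1 / √n) ^ 2) := by
        have := hu.2
        gcongr
      have h3 : (n : ℝ) * (C * (1 / √n) ^ 2) = C := by
        rw [div_pow, Real.sq_sqrt (Nat.cast_nonneg n)]
        have : (n : ℝ) ≠ 0 := fun h0 => by simp [h0] at hn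
        field_simp
      have h4 : (2 * (k : ℝ) + 1) * (m * (1 / (2 * √n))) ≤ (2 * k + 1) * (m * u) := by
        have := hu.1
        gcongr
      have h5 : (2 * (k : ℝ) + 1) * (m * (1 / (2 * √n))) = m / 2 * ((2 * k + 1) / √n) := by
        field_simp
      linarith
  rw [intervalIntegral.integral_const, smul_eq_mul] at h1
  have h2 := intervalIntegral.integral_mono_interval h0 hhalf hL
    (Eventually.of_forall fun u => (edgeWeight_pos w ℓ n k u).le)
    (h.intervalIntegrable_edgeWeight n k le_rfl h.L_pos.le le_rfl)
  refine le_trans (le_of_eq ?_) (h1.trans h2)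
  field_simp
  ring

theorem edgeRatio_bounds (h : IsHardEdgeProfile w ℓ L κ m c C M) {a : ℝ} (ha : 0 ≤ a) :
    ∀ᶠ n : ℕ in atTop, ∀ k < n, 0 ≤ edgeRatio w ℓ L a n k ∧ edgeRatio w ℓ L a n k ≤
      2 * a * Real.exp (2 * (M * a) + C) / √n * Real.exp (-(m / 2) * ((2 * k + 1) / √n)) := by
  have hM := h.M_pos
  have hn : Tendsto (fun n : ℕ => (n : ℝ)) atTop atTop := tendsto_natCast_atTop_atTop
  have hsqrt : Tendsto (fun n : ℕ => √(n : ℝ)) atTop atTop := Real.tendsto_sqrt_atTop.comp hn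
  filter_upwards [hn.eventually_gt_atTop 0, hsqrt.eventually_gt_atTop 0,
    (hn.const_div_atTop a).eventually_le_const h.L_pos,
    (hsqrt.const_div_atTop 1).eventually_le_const h.L_pos] with n h1 h2 h3 h4 k hk
  have h0 : 0 ≤ a / n := by positivity
  have hden := h.le_integral_edgeWeight k h2 h4
  have hdpos : 0 < ∫ u in (0 : ℝ)..L, edgeWeight w ℓ n k u := lt_of_lt_of_le (by positivity) hden
  refine ⟨div_nonneg (intervalIntegral.integral_nonneg h0 fun u _ => (edgeWeight_pos ..).le)
    hdpos.le, ?_⟩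
  have hk2 : (2 * (k : ℝ) + 1) / n ≤ 2 := by
    rw [div_le_iff₀ h1]
    have : (k : ℝ) + 1 ≤ n := by exact_mod_cast hk
    linarith
  have hnum := h.integral_window_le n k ha h1 h3
  have hnum' : ∫ u in (0 : ℝ)..a / n, edgeWeight w ℓ n k u ≤ a / n * Real.exp (2 * (M * a)) := by
    refine hnum.trans ?_
    gcongr
  rw [edgeRatio, div_le_iff₀ hdpos]
  calc _ ≤ a / n * Real.exp (2 * (M * a)) := hnum'
    _ = 2 * a * Real.exp (2 * (M * a) + C) / √n * Real.exp (-(m / 2) * ((2 * k + 1) / √n)) *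
        (1 / (2 * √n) * Real.exp (-C + m / 2 * ((2 * k + 1) / √n))) := by
      have hE := (Real.exp_pos (m / 2 * ((2 * k + 1) / √n))).ne'
      rw [neg_mul, Real.exp_add, Real.exp_add, Real.exp_neg, Real.exp_neg]
      generalize Real.exp (m / 2 * ((2 * k + 1) / √n)) = E at hE ⊢
      nth_rewrite 1 [← Real.mul_self_sqrt (Nat.cast_nonneg n)]
      field_simp
    _ ≤ _ := by gcongr

/-- The ratio at a sequence of indices growing like `√n`. -/
theorem tendsto_sqrt_mul_edgeRatio (h : IsHardEdgeProfile w ℓ L κ m c C M) {a : ℝ} (ha : 0 ≤ a)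
    {k : ℕ → ℕ} {t : ℝ}
    (ht : Tendsto (fun n : ℕ => (2 * (k n : ℝ) + 1) / √n) atTop (𝓝 t)) :
    Tendsto (fun n : ℕ => √n * edgeRatio w ℓ L a n (k n)) atTop
      (𝓝 (a * (∫ v in Set.Ioi (0 : ℝ), Real.exp (t * m * v - κ * v ^ 2))⁻¹)) := by
  have hκ := h.κ_pos
  have hm := h.m_pos
  have ht0 : 0 ≤ t := ge_of_tendsto' ht fun n => by positivity
  have hpos : 0 < ∫ v in Set.Ioi (0 : ℝ), Real.exp (t * m * v - κ * v ^ 2) := by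
    rw [integral_Ioi_exp_linear_sub_sq hκ]
    have h1 : 0 ≤ ∫ s in (0 : ℝ)..t * m / (2 * κ), Real.exp (-κ * s ^ 2) :=
      intervalIntegral.integral_nonneg (by positivity) fun s _ => (Real.exp_pos _).le
    positivity
  refine ((h.tendsto_mul_integral_window ha ht).mul
    ((h.tendsto_sqrt_mul_integral ht).inv₀ hpos.ne')).congr' ?_
  filter_upwards [eventually_gt_atTop 0] with n hn
  have h1 : 0 < √(n : ℝ) := Real.sqrt_pos.2 (Nat.cast_pos.2 hn)
  rw [edgeRatio, mul_inv, div_eq_mul_inv]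
  nth_rewrite 1 [← Real.mul_self_sqrt (Nat.cast_nonneg n)]
  field_simp

end IsHardEdgeProfile

theorem sum_range_eq_integral_floor (x : ℕ → ℝ) {n : ℕ} {s : ℝ} (hs : 0 < s) :
    ∑ k ∈ Finset.range n, x k =
      ∫ y in Set.Ioi (0 : ℝ), (Set.Ioo 0 (n / s)).indicator (fun y => s * x ⌊y * s⌋₊) y := by
  have hstep : ∀ k : ℕ, ∀ y ∈ Set.Ioo (k / s : ℝ) (((k + 1 : ℕ) : ℝ) / s),
      s * x ⌊y * s⌋₊ = s * x k := by
    intro k y hy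
    have h1 : ⌊y * s⌋₊ = k := by
      have h2 := (div_lt_iff₀ hs).1 hy.1
      have h3 := (lt_div_iff₀ hs).1 hy.2
      rw [Nat.floor_eq_iff ((Nat.cast_nonneg k).trans h2.le)]
      exact ⟨h2.le, by exact_mod_cast h3⟩
    rw [h1]
  have hle : ∀ k : ℕ, (k / s : ℝ) ≤ ((k + 1 : ℕ) : ℝ) / s := fun k => by
    gcongr
    simp
  have hpiece : ∀ k : ℕ, ∫ y in (k / s : ℝ)..((k + 1 : ℕ) : ℝ) / s, s * x ⌊y * s⌋₊ = x k := by
    intro k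
    rw [intervalIntegral.integral_of_le (hle k), integral_Ioc_eq_integral_Ioo,
      setIntegral_congr_fun measurableSet_Ioo (hstep k), ← integral_Ioc_eq_integral_Ioo,
      ← intervalIntegral.integral_of_le (hle k), intervalIntegral.integral_const, smul_eq_mul]
    push_cast
    field_simp
    ring
  have hint : ∀ k < n, IntervalIntegrable (fun y => s * x ⌊y * s⌋₊) volume
      (k / s : ℝ) (((k + 1 : ℕ) : ℝ) / s) := by
    intro k _
    rw [intervalIntegrable_iff_integrableOn_Ioo_of_le (hle k)]
    exact (integrableOn_congr_fun (hstep k) measurableSet_Ioo).2 (integrableOn_const (by simp))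
  have hsum := intervalIntegral.sum_integral_adjacent_intervals
    (a := fun k : ℕ => (k / s : ℝ)) hint
  simp only [hpiece] at hsum
  rw [hsum, setIntegral_indicator measurableSet_Ioo, Set.inter_eq_right.2 Set.Ioo_subset_Ioi_self,
    Nat.cast_zero, zero_div, intervalIntegral.integral_of_le (by positivity),
    integral_Ioc_eq_integral_Ioo]

namespace IsHardEdgeProfile

variable {w ℓ : ℝ → ℝ} {L κ m c C M : ℝ}

theorem tendsto_sum_edgeRatio (h : IsHardEdgeProfile w ℓ L κ m c C M) {a : ℝ} (ha : 0 ≤ a) :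
    Tendsto (fun n : ℕ => ∑ k ∈ Finset.range n, edgeRatio w ℓ L a n k) atTop
      (𝓝 (a * (κ / m * Real.log 2))) := by
  have hm := h.m_pos
  have hn : Tendsto (fun n : ℕ => (n : ℝ)) atTop atTop := tendsto_natCast_atTop_atTop
  have hsqrt : Tendsto (fun n : ℕ => √(n : ℝ)) atTop atTop := Real.tendsto_sqrt_atTop.comp hn
  rw [← integral_Ioi_inv_integral_Ioi_exp h.κ_pos h.m_pos, ← integral_const_mul]
  set F : ℕ → ℝ → ℝ := fun n => (Set.Ioo 0 (n / √(n : ℝ))).indicator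
    fun y => √n * edgeRatio w ℓ L a n ⌊y * √n⌋₊ with hF
  have hsum : ∀ᶠ n : ℕ in atTop, ∫ y in Set.Ioi (0 : ℝ), F n y =
      ∑ k ∈ Finset.range n, edgeRatio w ℓ L a n k :=
    (hsqrt.eventually_gt_atTop 0).mono fun n h1 => (sum_range_eq_integral_floor _ h1).symm
  refine Tendsto.congr' hsum ?_
  set K := 2 * a * Real.exp (2 * (M * a) + C) with hK
  have hKnn : 0 ≤ K := by positivity
  refine tendsto_integral_filter_of_dominated_convergence
    (fun y => K * Real.exp (-(m / 2) * y)) ?_ ?_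
    ((exp_neg_integrableOn_Ioi 0 (by positivity)).const_mul K) ?_
  · refine Eventually.of_forall fun n =>
      (Measurable.indicator ?_ measurableSet_Ioo).aestronglyMeasurable
    exact ((measurable_from_top (f := fun k : ℕ => edgeRatio w ℓ L a n k)).comp
      (Nat.measurable_floor.comp (measurable_id.mul_const _))).const_mul _
  · filter_upwards [hsqrt.eventually_gt_atTop 0, h.edgeRatio_bounds ha] with n h1 h2
    refine Eventually.of_forall fun y => ?_
    by_cases hy : y ∈ Set.Ioo 0 (n / √(n : ℝ))
    · have hlt : ⌊y * √n⌋₊ < n :=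
        (Nat.floor_lt (mul_nonneg hy.1.le h1.le)).2 ((lt_div_iff₀ h1).1 hy.2)
      obtain ⟨h3, h4⟩ := h2 _ hlt
      simp only [hF, Set.indicator_of_mem hy]
      rw [Real.norm_of_nonneg (mul_nonneg h1.le h3)]
      have h5 : y ≤ (2 * (⌊y * √n⌋₊ : ℝ) + 1) / √n := by
        rw [le_div_iff₀ h1]
        have := (Nat.lt_floor_add_one (y * √n)).le
        have h0 : (0 : ℝ) ≤ ⌊y * √n⌋₊ := Nat.cast_nonneg _
        linarith
      have h6 : -(m / 2) * ((2 * (⌊y * √n⌋₊ : ℝ) + 1) / √n) ≤ -(m / 2) * y :=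
        mul_le_mul_of_nonpos_left h5 (by linarith)
      calc √n * edgeRatio w ℓ L a n ⌊y * √n⌋₊
          ≤ √n * (K / √n * Real.exp (-(m / 2) * y)) := by
            refine mul_le_mul_of_nonneg_left (h4.trans ?_) h1.le
            gcongr
        _ = _ := by field_simp
    · simp only [hF, Set.indicator_of_notMem hy, norm_zero]
      positivity
  · filter_upwards [ae_restrict_mem measurableSet_Ioi] with y hy
    have hy0 : (0 : ℝ) < y := hy
    have ht : Tendsto (fun n : ℕ => (2 * (⌊y * √(n : ℝ)⌋₊ : ℝ) + 1) / √n) atTop (𝓝 (2 * y)) := by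
      have h1 := ((tendsto_nat_floor_mul_div_atTop hy0.le).comp hsqrt).const_mul 2
      have h2 := h1.add (hsqrt.const_div_atTop 1)
      rw [add_zero] at h2
      refine h2.congr fun n => ?_
      simp only [Function.comp_apply]
      ring
    refine (h.tendsto_sqrt_mul_edgeRatio ha ht).congr' ?_
    filter_upwards [hsqrt.eventually_gt_atTop y] with n h1
    have h2 : y ∈ Set.Ioo 0 (n / √(n : ℝ)) := ⟨hy0, by rwa [Real.div_sqrt]⟩
    simp only [hF, Set.indicator_of_mem h2]

end IsHardEdgeProfile

theorem xnk_eq_edgeRatio (Q : ℝ → ℝ) (r₀ R₀ δ ξ : ℝ) {n : ℕ} (hn : 0 < n)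
    (k : ℕ) :
    xnk Q r₀ R₀ δ n k ξ = edgeRatio
      (fun u => (Q (R₀ - u) - 2 * Real.log (R₀ - u)) - (Q R₀ - 2 * Real.log R₀))
      (fun u => Real.log R₀ - Real.log (R₀ - u)) (R₀ - r₀) (-ξ / (R₀ * δ * Real.log 4)) n k := by
  have hn0 : (n : ℝ) ≠ 0 := by exact_mod_cast hn.ne'
  have hint : ∀ b, ∫ r in b..R₀, Real.exp (-(n : ℝ) * Vnk Q n k r) =
      Real.exp (-(n : ℝ) * Vnk Q n k R₀) * ∫ u in (0 : ℝ)..R₀ - b, edgeWeight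
        (fun u => (Q (R₀ - u) - 2 * Real.log (R₀ - u)) - (Q R₀ - 2 * Real.log R₀))
        (fun u => Real.log R₀ - Real.log (R₀ - u)) n k u := by
    intro b
    rw [← intervalIntegral.integral_const_mul]
    have h1 := intervalIntegral.integral_comp_sub_left (a := 0) (b := R₀ - b)
      (fun r => Real.exp (-(n : ℝ) * Vnk Q n k r)) R₀
    rw [sub_sub_cancel, sub_zero] at h1
    rw [← h1]
    congr 1 with u
    rw [edgeWeight, ← Real.exp_add]
    congr 1
    unfold Vnk
    field_simp
    ring
  have hw : R₀ - xn R₀ δ n ξ = -ξ / (R₀ * δ * Real.log 4) / n := by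
    rw [xn, div_div]
    ring
  rw [xnk, edgeRatio, hint, hint, hw, mul_div_mul_left _ _ (Real.exp_pos _).ne']

/-- Order statistics for the hard edge ensemble: for `g_n(λ) = ∏_{k<n} (1 + λ x_{n,k}(ξ))`,
`Σ_{k=0}^{l−1} g_n^{(k)}(−1)/k! → e^ξ Σ_{k=0}^{l−1} (−ξ)^k/k!`. -/
theorem hard_edge_radial_order_statistics
    (Q : ℝ → ℝ) (r₀ R₀ δ : ℝ)
    (hQ : ContDiffOn ℝ 3 Q (Set.Ioi 0))
    (hsub : ∀ r > (0 : ℝ), 0 ≤ deriv (deriv Q) r + deriv Q r / r)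
    (hstrict : ∃ ε > (0 : ℝ), ∀ r ∈ Set.Ioo (R₀ - ε) (R₀ + ε),
        0 < deriv (deriv Q) r + deriv Q r / r)
    (hr₀ : r₀ = sInf {t : ℝ | 0 < t ∧ ∀ r > t, 0 < deriv Q r})
    (hR₀ : R₀ * deriv Q R₀ = 2)
    (hR₀min : ∀ R > (0 : ℝ), R * deriv Q R = 2 → R₀ ≤ R)
    (hr₀pos : 0 < r₀) (hr₀R₀ : r₀ < R₀)
    (hδ : δ = (1 / 4) * (deriv (deriv Q) R₀ + deriv Q R₀ / R₀)) (hδpos : 0 < δ)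
    (l : ℕ) (hl : 1 ≤ l) (ξ : ℝ) (hξ : ξ ≤ 0) :
    Tendsto
      (fun n : ℕ =>
        ∑ k ∈ Finset.range l, (1 / (Nat.factorial k : ℂ)) *
          iteratedDeriv k
            (fun z : ℂ => ∏ j ∈ Finset.range n, (1 + z * (xnk Q r₀ R₀ δ n j ξ : ℂ))) (-1))
      atTop
      (nhds ((Real.exp ξ : ℂ) *
        ∑ k ∈ Finset.range l, (-(ξ : ℂ)) ^ k / (Nat.factorial k : ℂ))) := by
  have hR₀pos : 0 < R₀ := hr₀pos.trans hr₀R₀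
  have hlog4 : Real.log 4 = 2 * Real.log 2 := by
    rw [show (4 : ℝ) = 2 ^ 2 by norm_num, Real.log_pow]
    norm_num
  have hlog2 : 0 < Real.log 2 := Real.log_pos one_lt_two
  obtain ⟨c, C, h⟩ := isHardEdgeProfile_of_contDiffOn hQ hsub hR₀ hr₀pos hr₀R₀ hδ hδpos
  set a := -ξ / (R₀ * δ * Real.log 4) with ha
  have ha0 : 0 ≤ a := by
    rw [ha, hlog4]
    exact div_nonneg (by linarith) (by positivity)
  have hn : Tendsto (fun n : ℕ => (n : ℝ)) atTop atTop := tendsto_natCast_atTop_atTop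
  have hsqrt : Tendsto (fun n : ℕ => √(n : ℝ)) atTop atTop := Real.tendsto_sqrt_atTop.comp hn
  have hsum : Tendsto (fun n : ℕ => ∑ k ∈ Finset.range n, xnk Q r₀ R₀ δ n k ξ) atTop (𝓝 (-ξ)) := by
    have hval : a * (2 * δ / (1 / R₀) * Real.log 2) = -ξ := by
      rw [ha, hlog4]
      field_simp
    rw [← hval]
    refine (h.tendsto_sum_edgeRatio ha0).congr' ?_
    filter_upwards [eventually_gt_atTop 0] with n hn
    exact Finset.sum_congr rfl fun k _ => (xnk_eq_edgeRatio Q r₀ R₀ δ ξ hn k).symm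
  have hbound : ∀ᶠ n : ℕ in atTop, ∀ k < n, 0 ≤ xnk Q r₀ R₀ δ n k ξ ∧
      xnk Q r₀ R₀ δ n k ξ ≤ 2 * a * Real.exp (2 * (1 / r₀ * a) + C) / √n := by
    filter_upwards [eventually_gt_atTop 0, h.edgeRatio_bounds ha0] with n hn hb k hk
    rw [xnk_eq_edgeRatio Q r₀ R₀ δ ξ hn k]
    refine ⟨(hb k hk).1, (hb k hk).2.trans (mul_le_of_le_one_right (by positivity) ?_)⟩
    rw [Real.exp_le_one_iff, neg_mul, neg_nonpos]
    positivity
  have hmain := tendsto_sum_iteratedDeriv_prod_one_add_mul hbound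
    (hsqrt.const_div_atTop _) hsum l
  simpa only [neg_neg, Complex.ofReal_neg] using hmain
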